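/- Let x, y > 0 with x ≤ y ≤ 2^{-8}, and let G be a y³-sparse graph with no copy of the complement of P5 and with |G| ≥ y^{-4}. Then either: (1) G is 2y⁴-sparse; or (2) there exist a real k with y^{-1/4} ≤ k ≤ 1/x and a pure (k, |G|/k^{26})-blockade in G; or (3) there are disjoint X, Y ⊆ V(G) such that |X| ≥ y⁴·|G|, |Y| ≥ (1 − 4y)·|G|, and Y is x-sparse to X in G. -/

import Mathlib

open Finset
open scoped Classical

/-- A copy of `H` in `G`: an injective map preserving adjacency and non-adjacency. -/
def IsCopy {W V : Type*} (H : SimpleGraph W) (G : SimpleGraph V) (f : W → V) : Prop :=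
  Function.Injective f ∧ ∀ u v : W, H.Adj u v ↔ G.Adj (f u) (f v)

/-- `G` is `H`-free: there is no copy of `H` in `G`. -/
def Free {W V : Type*} (H : SimpleGraph W) (G : SimpleGraph V) : Prop :=
  ¬ ∃ f : W → V, IsCopy H G f

/-- The path on five vertices. -/
def P5 : SimpleGraph (Fin 5) := SimpleGraph.pathGraph 5

/-- The neighbours of `v` inside the finite set `A`. -/
noncomputable def nbrsIn {V : Type*} (G : SimpleGraph V) (v : V) (A : Finset V) : Finset V :=
  A.filter (fun u => G.Adj v u)

/-- `G` is `x`-sparse: every vertex has degree at most `x * |G|`. -/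
def Sparse {V : Type*} [Fintype V] (G : SimpleGraph V) (x : ℝ) : Prop :=
  ∀ v : V, ((nbrsIn G v Finset.univ).card : ℝ) ≤ x * (Fintype.card V : ℝ)

/-- `G` is `x`-restricted: `G` or its complement is `x`-sparse. -/
def Restricted {V : Type*} [Fintype V] (G : SimpleGraph V) (x : ℝ) : Prop :=
  Sparse G x ∨ Sparse Gᶜ x

/-- The induced subgraph `G[S]` is `x`-sparse. -/
def SparseOn {V : Type*} (G : SimpleGraph V) (S : Finset V) (x : ℝ) : Prop :=
  ∀ v ∈ S, ((nbrsIn G v S).card : ℝ) ≤ x * (S.card : ℝ)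

/-- The induced subgraph `G[S]` is `x`-restricted: it or its complement is `x`-sparse. -/
def RestrictedOn {V : Type*} (G : SimpleGraph V) (S : Finset V) (x : ℝ) : Prop :=
  SparseOn G S x ∨ SparseOn Gᶜ S x

/-- `(A, B)` is complete in `G`. -/
def CompletePair {V : Type*} (G : SimpleGraph V) (A B : Finset V) : Prop :=
  ∀ a ∈ A, ∀ b ∈ B, G.Adj a b

/-- `(A, B)` is anticomplete in `G`. -/
def AnticompletePair {V : Type*} (G : SimpleGraph V) (A B : Finset V) : Prop :=
  ∀ a ∈ A, ∀ b ∈ B, ¬ G.Adj a b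

/-- `B` is `x`-sparse to `A` in `G`: every vertex of `B` has at most `x * |A|` neighbours in `A`. -/
def SparseTo {V : Type*} (G : SimpleGraph V) (x : ℝ) (A B : Finset V) : Prop :=
  ∀ v ∈ B, ((nbrsIn G v A).card : ℝ) ≤ x * (A.card : ℝ)

/-- The number of edges of `G` between `A` and `B`. -/
noncomputable def edgesBetween {V : Type*} (G : SimpleGraph V) (A B : Finset V) : ℕ :=
  ((A ×ˢ B).filter (fun p => G.Adj p.1 p.2)).card

/-- `(A, B)` is weakly `x`-sparse in `G`. -/
def WeaklySparse {V : Type*} (G : SimpleGraph V) (x : ℝ) (A B : Finset V) : Prop :=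
  (edgesBetween G A B : ℝ) ≤ x * (A.card : ℝ) * (B.card : ℝ)

/-- A blockade: a sequence of pairwise disjoint vertex subsets. -/
def IsBlockade {V : Type*} {n : ℕ} (B : Fin n → Finset V) : Prop :=
  ∀ i j : Fin n, i ≠ j → Disjoint (B i) (B j)

/-- A pure blockade: every pair of distinct blocks is complete or anticomplete. -/
def PureBlockade {V : Type*} (G : SimpleGraph V) {n : ℕ} (B : Fin n → Finset V) : Prop :=
  ∀ i j : Fin n, i ≠ j → CompletePair G (B i) (B j) ∨ AnticompletePair G (B i) (B j)

/-- A complete blockade. -/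
def CompleteBlockade {V : Type*} (G : SimpleGraph V) {n : ℕ} (B : Fin n → Finset V) : Prop :=
  ∀ i j : Fin n, i ≠ j → CompletePair G (B i) (B j)

/-- An anticomplete blockade. -/
def AnticompleteBlockade {V : Type*} (G : SimpleGraph V) {n : ℕ} (B : Fin n → Finset V) : Prop :=
  ∀ i j : Fin n, i ≠ j → AnticompletePair G (B i) (B j)

/-- An `x`-sparse blockade: `B j` is `x`-sparse to `B i` whenever `i < j`. -/
def SparseBlockade {V : Type*} (G : SimpleGraph V) (x : ℝ) {n : ℕ} (B : Fin n → Finset V) : Prop :=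
  ∀ i j : Fin n, i < j → SparseTo G x (B i) (B j)

/-- A comb: a blockade `Bl` together with distinct apexes `a i`, outside all blocks, such that
`a i` is adjacent to all of `Bl i` and nonadjacent to all of `Bl j` for `j ≠ i`. -/
def IsComb {V : Type*} (G : SimpleGraph V) {k : ℕ} (a : Fin k → V) (Bl : Fin k → Finset V) :
    Prop :=
  IsBlockade Bl ∧ Function.Injective a ∧ (∀ i j : Fin k, a i ∉ Bl j) ∧
  (∀ i : Fin k, ∀ v ∈ Bl i, G.Adj (a i) v) ∧
  (∀ i j : Fin k, i ≠ j → ∀ v ∈ Bl j, ¬ G.Adj (a i) v)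

/-- Nested finite sets obtained by repeatedly deleting the neighbours of a vertex of `Q` with the
most neighbours in the current set. -/
theorem exists_greedy_sequence {V : Type*} (G : SimpleGraph V) (A Q : Finset V)
    (hQ : Q.Nonempty) :
    ∃ (X : ℕ → Finset V) (b : ℕ → V), X 0 = A ∧ (∀ n, b n ∈ Q) ∧
      (∀ n, X (n + 1) = X n \ nbrsIn G (b n) (X n)) ∧
      ∀ n, ∀ u ∈ Q, (nbrsIn G u (X n)).card ≤ (nbrsIn G (b n) (X n)).card := by
  have hmax : ∀ S : Finset V, ∃ s ∈ Q, ∀ u ∈ Q, (nbrsIn G u S).card ≤ (nbrsIn G s S).card :=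
    fun S => Finset.exists_max_image Q (fun u => (nbrsIn G u S).card) hQ
  choose s hsQ hs using hmax
  let X : ℕ → Finset V := fun n => Nat.rec A (fun _ S => S \ nbrsIn G (s S) S) n
  exact ⟨X, fun n => s (X n), rfl, fun n => hsQ _, fun n => rfl, fun n => hs _⟩

theorem sum_one_div_sqrt_cube_le (N M : ℕ) (hN : 2 ≤ N) (hM : N ≤ M) :
    ∑ n ∈ Finset.Ico N M, 1 / (√(n : ℝ)) ^ 3 ≤
      2 / √((N : ℝ) - 1) - 2 / √((M : ℝ) - 1) := by
  induction M, hM using Nat.le_induction with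
  | base => simp
  | succ m hm ih =>
    rw [Finset.sum_Ico_succ_top hm]
    have hm2 : (2 : ℝ) ≤ m := by exact_mod_cast hN.trans hm
    push_cast
    rw [add_sub_cancel_right]
    set s := √((m : ℝ) - 1) with hs
    set t := √(m : ℝ) with ht
    have hs0 : 0 < s := Real.sqrt_pos.2 (by linarith)
    have hst : s ≤ t := Real.sqrt_le_sqrt (by linarith)
    have ht0 : 0 < t := hs0.trans_le hst
    have hs2 : s ^ 2 = m - 1 := Real.sq_sqrt (by linarith)
    have ht2 : t ^ 2 = m := Real.sq_sqrt (by linarith)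
    have key : 1 / t ^ 3 ≤ 2 / s - 2 / t := by
      rw [div_sub_div _ _ hs0.ne' ht0.ne', div_le_div_iff₀ (by positivity) (by positivity)]
      have h1 : (t - s) * (t + s) = 1 := by nlinarith
      have h2 : 1 ≤ 2 * t * (t - s) := by nlinarith
      nlinarith [mul_le_mul_of_nonneg_left h2 (sq_nonneg t), mul_nonneg ht0.le (sub_nonneg.2 hst)]
    linarith

/-- A sum of small terms contains a late term that is not too small. -/
theorem exists_late_large_term (p : ℕ → ℝ) (a r : ℝ) (M : ℕ) (ha : 0 < a) (hr : 256 ≤ r)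
    (hp : ∀ i, p i ≤ a / r ^ 2) (hsum : a / 2 < ∑ i ∈ Finset.range M, p i) :
    ∃ n < M, r ^ 2 / 9 ≤ (n : ℝ) ∧ a * r / (24 * √(n : ℝ) ^ 3) ≤ p n := by
  have hr0 : 0 < r := by linarith
  have hr2 : (256 : ℝ) ^ 2 ≤ r ^ 2 := pow_le_pow_left₀ (by norm_num) hr 2
  have hinit : ∀ m : ℕ, ∑ i ∈ Finset.range m, p i ≤ m * (a / r ^ 2) := fun m => by
    simpa using Finset.sum_le_card_nsmul (Finset.range m) p _ (fun i _ => hp i)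
  set N := ⌊r ^ 2 / 4⌋₊ with hN
  have hN1 : (N : ℝ) ≤ r ^ 2 / 4 := Nat.floor_le (by positivity)
  have hN2 : r ^ 2 / 4 < N + 1 := Nat.lt_floor_add_one _
  have hNsum : ∀ m ≤ N, ∑ i ∈ Finset.range m, p i ≤ a / 4 := fun m hm => by
    have hm' : (m : ℝ) ≤ N := by exact_mod_cast hm
    calc _ ≤ _ := hinit m
      _ ≤ r ^ 2 / 4 * (a / r ^ 2) := by gcongr; linarith
      _ = a / 4 := by field_simp
  have hNM : N ≤ M := by
    by_contra! h
    linarith [hNsum M h.le]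
  by_contra! hcon
  have hlow : ∀ n ∈ Finset.Ico N M, p n ≤ a * r / 24 * (1 / √(n : ℝ) ^ 3) := fun n hn => by
    rw [Finset.mem_Ico] at hn
    have hn' : (N : ℝ) ≤ n := by exact_mod_cast hn.1
    refine (hcon n hn.2 (by linarith)).le.trans (le_of_eq ?_)
    rw [div_mul_div_comm, mul_one]
  have htail : ∑ n ∈ Finset.Ico N M, p n ≤ a / 4 := by
    have hNreal : (2 : ℝ) ≤ N := by linarith
    have hs : r / 3 ≤ √((N : ℝ) - 1) := Real.le_sqrt_of_sq_le (by nlinarith)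
    calc ∑ n ∈ Finset.Ico N M, p n
        ≤ ∑ n ∈ Finset.Ico N M, a * r / 24 * (1 / √(n : ℝ) ^ 3) := Finset.sum_le_sum hlow
      _ = a * r / 24 * ∑ n ∈ Finset.Ico N M, 1 / √(n : ℝ) ^ 3 := by rw [Finset.mul_sum]
      _ ≤ a * r / 24 * (2 / (r / 3)) := by
          gcongr
          calc _ ≤ _ := sum_one_div_sqrt_cube_le N M (by exact_mod_cast hNreal) hNM
            _ ≤ 2 / √((N : ℝ) - 1) := sub_le_self _ (by positivity)
            _ ≤ _ := by gcongr
      _ = a / 4 := by field_simp; norm_num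
  have := Finset.sum_range_add_sum_Ico p hNM
  linarith [hNsum N le_rfl]

/-- If every element of `I` is related to at most `d` elements of `I`, then `I` has a large subset
without related pairs in decreasing order. -/
theorem exists_subset_card_eq_of_forall_card_le (R : ℕ → ℕ → Prop) (d K : ℕ) (I : Finset ℕ)
    (hd : ∀ i ∈ I, (I.filter (R i)).card ≤ d) (hI : K * (d + 1) ≤ I.card) :
    ∃ J ⊆ I, J.card = K ∧ ∀ i ∈ J, ∀ j ∈ J, j < i → ¬ R i j := by
  induction K generalizing I with
  | zero => exact ⟨∅, by simp, rfl, by simp⟩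
  | succ K ih =>
    have hne : I.Nonempty := Finset.card_pos.1 (by nlinarith)
    set m := I.max' hne with hm
    have hmI : m ∈ I := I.max'_mem hne
    set I' := (I.erase m) \ I.filter (R m) with hI'
    have hsub : I' ⊆ I := Finset.sdiff_subset.trans (Finset.erase_subset _ _)
    have hcard : K * (d + 1) ≤ I'.card := by
      have h1 : _ ≤ I'.card := Finset.le_card_sdiff (I.filter (R m)) (I.erase m)
      have h2 := Finset.card_erase_of_mem hmI
      have h3 := hd m hmI
      have h4 : (K + 1) * (d + 1) = K * (d + 1) + (d + 1) := by ring
      omega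
    obtain ⟨J, hJI, hJ, hR⟩ := ih I' (fun i hi =>
      (Finset.card_le_card (Finset.filter_subset_filter _ hsub)).trans (hd i (hsub hi))) hcard
    have hlt : ∀ j ∈ J, j < m := fun j hj => by
      have h1 := hJI hj
      simp only [hI', Finset.mem_sdiff, Finset.mem_erase] at h1
      exact lt_of_le_of_ne (I.le_max' j h1.1.2) h1.1.1
    have hmJ : m ∉ J := fun h => lt_irrefl _ (hlt m h)
    refine ⟨insert m J, Finset.insert_subset hmI (hJI.trans hsub), by
      rw [Finset.card_insert_of_notMem hmJ, hJ], ?_⟩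
    intro i hi j hj hji
    rcases Finset.mem_insert.1 hi with rfl | hi
    · rcases Finset.mem_insert.1 hj with rfl | hj
      · exact absurd hji (lt_irrefl _)
      · have h1 := hJI hj
        simp only [hI', Finset.mem_sdiff, Finset.mem_erase, Finset.mem_filter, not_and] at h1
        exact h1.2 h1.1.2
    · rcases Finset.mem_insert.1 hj with rfl | hj
      · exact absurd (hji.trans (hlt i hi)) (lt_irrefl _)
      · exact hR i hi j hj hji

/-- `C` is anticonnected: it is not the union of two nonempty sets complete to each other. -/
def Anticonnected {V : Type*} (G : SimpleGraph V) (C : Finset V) : Prop :=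
  ∀ S ⊆ C, S.Nonempty → (C \ S).Nonempty → ¬ CompletePair G S (C \ S)

theorem CompletePair.symm {V : Type*} {G : SimpleGraph V} {A B : Finset V}
    (h : CompletePair G A B) : CompletePair G B A :=
  fun b hb a ha => (h a ha b hb).symm

/-- A set without large anticonnected subsets splits off a set of bounded size that is complete to
the rest. -/
theorem exists_split_of_not_anticonnected {V : Type*} (G : SimpleGraph V) (t : ℝ) (Z : Finset V)
    (hZ : t ≤ Z.card) (hno : ∀ C ⊆ Z, t ≤ C.card → ¬ Anticonnected G C) :
    ∃ W ⊆ Z, t ≤ W.card ∧ (W.card : ℝ) < 2 * t ∧ CompletePair G W (Z \ W) := by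
  let F := Z.powerset.filter fun W => t ≤ (W.card : ℝ) ∧ CompletePair G W (Z \ W)
  have hF : F.Nonempty := ⟨Z, by
    simp only [F, Finset.mem_filter, Finset.mem_powerset, Finset.sdiff_self]
    exact ⟨subset_rfl, hZ, fun _ _ _ h => absurd h (Finset.notMem_empty _)⟩⟩
  obtain ⟨W, hWF, hmin⟩ := Finset.exists_min_image F Finset.card hF
  simp only [F, Finset.mem_filter, Finset.mem_powerset] at hWF hmin
  obtain ⟨hWZ, htW, hWc⟩ := hWF
  refine ⟨W, hWZ, htW, ?_, hWc⟩
  have hW := hno W hWZ htW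
  simp only [Anticonnected, not_forall, not_not] at hW
  obtain ⟨S, hSW, hS, hS', hc⟩ := hW
  have small : ∀ S ⊆ W, (W \ S).Nonempty → CompletePair G S (W \ S) → (S.card : ℝ) < t := by
    intro S hSW hS' hc
    by_contra! h
    have hlt : S.card < W.card :=
      Finset.card_lt_card ⟨hSW, fun h => hS'.ne_empty (Finset.sdiff_eq_empty_iff_subset.2 h)⟩
    refine absurd (hmin S ⟨hSW.trans hWZ, h, fun s hs u hu => ?_⟩) (not_le.2 hlt)
    rw [Finset.mem_sdiff] at hu
    by_cases huW : u ∈ W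
    · exact hc s hs u (Finset.mem_sdiff.2 ⟨huW, hu.2⟩)
    · exact hWc s (hSW hs) u (Finset.mem_sdiff.2 ⟨hu.1, huW⟩)
  have h1 := small S hSW hS' hc
  have hWS : W \ (W \ S) = S := Finset.sdiff_sdiff_eq_self hSW
  have h2 := small (W \ S) Finset.sdiff_subset (by rwa [hWS]) (by rw [hWS]; exact hc.symm)
  have h3 : ((W \ S).card : ℝ) + S.card = W.card := by
    exact_mod_cast Finset.card_sdiff_add_card_eq_card hSW
  linarith

/-- A set without large anticonnected subsets contains a complete blockade. -/
theorem exists_completeBlockade_of_not_anticonnected {V : Type*} (G : SimpleGraph V) (t : ℝ)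
    (ht : 0 ≤ t) (K : ℕ) (Z : Finset V) (hZ : 2 * t * K ≤ Z.card)
    (hno : ∀ C ⊆ Z, t ≤ C.card → ¬ Anticonnected G C) :
    ∃ B : Fin K → Finset V, (∀ i, B i ⊆ Z) ∧ IsBlockade B ∧ (∀ i, t ≤ ((B i).card : ℝ)) ∧
      CompleteBlockade G B := by
  induction K generalizing Z with
  | zero => exact ⟨fun _ => ∅, fun i => i.elim0, fun i => i.elim0, fun i => i.elim0,
      fun i => i.elim0⟩
  | succ K ih =>
    push_cast at hZ
    have hK : (0 : ℝ) ≤ t * K := by positivity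
    obtain ⟨W, hWZ, htW, hW2, hWc⟩ :=
      exists_split_of_not_anticonnected G t Z (by linarith) hno
    have hcard : ((Z \ W).card : ℝ) + W.card = Z.card := by
      exact_mod_cast Finset.card_sdiff_add_card_eq_card hWZ
    obtain ⟨B, hBZ, hB, htB, hBc⟩ := ih (Z \ W) (by linarith)
      (fun C hC => hno C (hC.trans Finset.sdiff_subset))
    have hdis : ∀ i, Disjoint W (B i) := fun i =>
      Finset.disjoint_of_subset_right (hBZ i) Finset.disjoint_sdiff
    refine ⟨Fin.cons W B, Fin.cases hWZ fun i => (hBZ i).trans Finset.sdiff_subset, ?_,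
      Fin.cases htW htB, ?_⟩
    · intro i j
      refine Fin.cases ?_ (fun i => ?_) i <;> refine Fin.cases ?_ (fun j => ?_) j
      · exact fun h => absurd rfl h
      · exact fun _ => hdis j
      · exact fun _ => (hdis i).symm
      · exact fun h => hB i j fun e => h (by rw [e])
    · intro i j
      refine Fin.cases ?_ (fun i => ?_) i <;> refine Fin.cases ?_ (fun j => ?_) j
      · exact fun h => absurd rfl h
      · exact fun _ a ha c hc => hWc a ha c (hBZ j hc)
      · exact fun _ c hc a ha => (hWc a ha c (hBZ i hc)).symm
      · exact fun h => hBc i j fun e => h (by rw [e])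

/-- If `v` and `b` are nonadjacent, then a neighbour of `v` that is not adjacent to `b` does not
distinguish two nonadjacent common neighbours of `v` and `b`. -/
theorem adj_of_house_free {V : Type*} {G : SimpleGraph V} (hfree : Free P5ᶜ G) {v b a s s' : V}
    (hvb : ¬ G.Adj v b) (hva : G.Adj v a) (hvs : G.Adj v s) (hvs' : G.Adj v s')
    (hbs : G.Adj b s) (hbs' : G.Adj b s') (hba : ¬ G.Adj b a) (hss' : ¬ G.Adj s s')
    (has : G.Adj a s) : G.Adj a s' := by
  by_contra has'
  apply hfree
  have h01 : v ≠ b := by rintro rfl; exact hba hva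
  have h02 := hva.ne
  have h03 := hvs'.ne
  have h04 := hvs.ne
  have h12 : b ≠ a := by rintro rfl; exact hvb hva
  have h13 := hbs'.ne
  have h14 := hbs.ne
  have h23 : a ≠ s' := by rintro rfl; exact hss' has.symm
  have h24 := has.ne
  have h34 : s' ≠ s := by rintro rfl; exact has' has
  have c1 : ¬ G.Adj b v := fun h => hvb h.symm
  have c2 : ¬ G.Adj a b := fun h => hba h.symm
  have c3 : ¬ G.Adj s' a := fun h => has' h.symm
  have c4 : ¬ G.Adj s' s := fun h => hss' h.symm
  refine ⟨![v, b, a, s', s], ?_, ?_⟩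
  · intro i j hij
    fin_cases i <;> fin_cases j <;> simp_all
  · intro i j
    fin_cases i <;> fin_cases j <;>
      simp [P5, SimpleGraph.pathGraph_adj, *, hva.symm, hvs.symm, hvs'.symm, hbs.symm, hbs'.symm,
        has.symm]

/-- A neighbour of `v` outside the neighbourhood of `b` is complete or anticomplete to each
anticonnected set of common neighbours of `v` and `b`. -/
theorem Anticonnected.forall_adj_or_forall_not_adj {V : Type*} {G : SimpleGraph V}
    (hfree : Free P5ᶜ G) {v b a : V} {C : Finset V} (hC : Anticonnected G C)
    (hvb : ¬ G.Adj v b) (hva : G.Adj v a) (hba : ¬ G.Adj b a)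
    (hvC : ∀ c ∈ C, G.Adj v c) (hbC : ∀ c ∈ C, G.Adj b c) :
    (∀ c ∈ C, G.Adj a c) ∨ ∀ c ∈ C, ¬ G.Adj a c := by
  by_contra! h
  obtain ⟨⟨s', hs'C, hs'⟩, s, hsC, hs⟩ := h
  refine hC (nbrsIn G a C) (Finset.filter_subset _ _) ⟨s, by simp [nbrsIn, hsC, hs]⟩
    ⟨s', by simp [nbrsIn, hs'C, hs']⟩ ?_
  intro c hc c' hc'
  simp only [nbrsIn, Finset.mem_sdiff, Finset.mem_filter, not_and] at hc hc'
  by_contra hcc'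
  exact hc'.2 hc'.1 (adj_of_house_free hfree hvb hva (hvC c hc.1) (hvC c' hc'.1) (hbC c hc.1)
    (hbC c' hc'.1) hba hcc' hc.2)

theorem Anticonnected.completePair_or_anticompletePair {V : Type*} {G : SimpleGraph V}
    (hfree : Free P5ᶜ G) {v b b' : V} {C C' : Finset V} (hC : Anticonnected G C)
    (hC' : Anticonnected G C') (hvb : ¬ G.Adj v b) (hvb' : ¬ G.Adj v b')
    (hvC : ∀ c ∈ C, G.Adj v c) (hvC' : ∀ c ∈ C', G.Adj v c)
    (hbC : ∀ c ∈ C, G.Adj b c) (hbC' : ∀ c ∈ C', ¬ G.Adj b c)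
    (hb'C : ∀ c ∈ C, ¬ G.Adj b' c) (hb'C' : ∀ c ∈ C', G.Adj b' c) :
    CompletePair G C C' ∨ AnticompletePair G C C' := by
  have h1 : ∀ a ∈ C, (∀ c ∈ C', G.Adj a c) ∨ ∀ c ∈ C', ¬ G.Adj a c := fun a ha =>
    hC'.forall_adj_or_forall_not_adj hfree hvb' (hvC a ha) (hb'C a ha) hvC' hb'C'
  have h2 : ∀ a ∈ C', (∀ c ∈ C, G.Adj a c) ∨ ∀ c ∈ C, ¬ G.Adj a c := fun a ha =>
    hC.forall_adj_or_forall_not_adj hfree hvb (hvC' a ha) (hbC' a ha) hvC hbC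
  by_contra! h
  simp only [CompletePair, AnticompletePair, not_forall, not_not] at h
  obtain ⟨⟨a, ha, c, hc, hac⟩, a', ha', c', hc', hac'⟩ := h
  have h3 := (h1 a' ha').resolve_right fun h => h c' hc' hac'
  have h4 := (h2 c hc).resolve_right fun h => h a' ha' (h3 c hc).symm
  exact hac (h4 a ha).symm

/-- In a house-free graph, a comb inside the neighbourhood of a vertex `v` whose apexes are not
adjacent to `v` yields a pure blockade. -/
theorem exists_pureBlockade_of_comb {V : Type*} {G : SimpleGraph V} (hfree : Free P5ᶜ G) {v : V}
    {K : ℕ} {t : ℝ} (ht : 0 < t) (b : Fin K → V) (Z : Fin K → Finset V) (hZ : IsBlockade Z)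
    (hvb : ∀ i, ¬ G.Adj v (b i)) (hvZ : ∀ i, ∀ c ∈ Z i, G.Adj v c)
    (hbZ : ∀ i, ∀ c ∈ Z i, G.Adj (b i) c)
    (hbZ' : ∀ i j, i ≠ j → ∀ c ∈ Z j, ¬ G.Adj (b i) c)
    (hcard : ∀ i, 2 * t * K ≤ ((Z i).card : ℝ)) :
    ∃ B : Fin K → Finset V, IsBlockade B ∧ (∀ i, t ≤ ((B i).card : ℝ)) ∧ PureBlockade G B := by
  by_cases h : ∀ i, ∃ C ⊆ Z i, t ≤ (C.card : ℝ) ∧ Anticonnected G C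
  · choose C hCZ hCt hC using h
    refine ⟨C, fun i j hij => Finset.disjoint_of_subset_left (hCZ i)
      (Finset.disjoint_of_subset_right (hCZ j) (hZ i j hij)), hCt, fun i j hij => ?_⟩
    exact (hC i).completePair_or_anticompletePair hfree (hC j) (hvb i) (hvb j)
      (fun c hc => hvZ i c (hCZ i hc)) (fun c hc => hvZ j c (hCZ j hc))
      (fun c hc => hbZ i c (hCZ i hc)) (fun c hc => hbZ' i j hij c (hCZ j hc))
      (fun c hc => hbZ' j i hij.symm c (hCZ i hc)) (fun c hc => hbZ j c (hCZ j hc))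
  · push Not at h
    obtain ⟨i, hi⟩ := h
    obtain ⟨B, -, hB, hBt, hBc⟩ :=
      exists_completeBlockade_of_not_anticonnected G t ht.le K (Z i) (hcard i) hi
    exact ⟨B, hB, hBt, fun i j hij => Or.inl (hBc i j hij)⟩

theorem nbrsIn_subset_nbrsIn {V : Type*} (G : SimpleGraph V) (v : V) {A B : Finset V}
    (h : A ⊆ B) : nbrsIn G v A ⊆ nbrsIn G v B :=
  Finset.filter_subset_filter _ h

section Greedy

variable {V : Type*} {G : SimpleGraph V} {X : ℕ → Finset V} {b : ℕ → V}

theorem antitone_of_greedy (hX : ∀ n, X (n + 1) = X n \ nbrsIn G (b n) (X n)) : Antitone X :=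
  antitone_nat_of_succ_le fun n => by rw [hX n]; exact Finset.sdiff_subset

theorem not_adj_of_greedy (hX : ∀ n, X (n + 1) = X n \ nbrsIn G (b n) (X n)) {i j : ℕ}
    (hij : i < j) {c : V} (hc : c ∈ X j) : ¬ G.Adj (b i) c := by
  have h := antitone_of_greedy hX (Nat.succ_le_of_lt hij) hc
  rw [Nat.succ_eq_add_one, hX i, Finset.mem_sdiff] at h
  exact fun hadj => h.2 (Finset.mem_filter.2 ⟨h.1, hadj⟩)

theorem disjoint_of_greedy (hX : ∀ n, X (n + 1) = X n \ nbrsIn G (b n) (X n)) {i j : ℕ}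
    (hij : i ≠ j) : Disjoint (nbrsIn G (b i) (X i)) (nbrsIn G (b j) (X j)) := by
  wlog h : i < j generalizing i j
  · exact (this hij.symm (by omega)).symm
  refine Finset.disjoint_left.2 fun c hci hcj => ?_
  exact not_adj_of_greedy hX h (Finset.mem_filter.1 hcj).1 (Finset.mem_filter.1 hci).2

theorem card_add_sum_of_greedy (hX : ∀ n, X (n + 1) = X n \ nbrsIn G (b n) (X n)) (n : ℕ) :
    (X n).card + ∑ i ∈ Finset.range n, (nbrsIn G (b i) (X i)).card = (X 0).card := by
  induction n with
  | zero => simp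
  | succ n ih =>
    rw [Finset.sum_range_succ, ← ih, hX n]
    have : (X n \ nbrsIn G (b n) (X n)).card + (nbrsIn G (b n) (X n)).card = (X n).card :=
      Finset.card_sdiff_add_card_eq_card (Finset.filter_subset _ _)
    omega

theorem sum_card_nbrsIn_le_of_greedy (hX : ∀ n, X (n + 1) = X n \ nbrsIn G (b n) (X n))
    (F : Finset ℕ) (h : ℕ) (hF : ∀ j ∈ F, h ≤ j) (u : V) :
    ∑ j ∈ F, (nbrsIn G u (nbrsIn G (b j) (X j))).card ≤ (nbrsIn G u (X h)).card := by
  have hdis : ∀ j ∈ F, ∀ k ∈ F, j ≠ k → Disjoint (nbrsIn G u (nbrsIn G (b j) (X j)))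
      (nbrsIn G u (nbrsIn G (b k) (X k))) := fun j _ k _ hjk =>
    Finset.disjoint_of_subset_left (Finset.filter_subset _ _)
      (Finset.disjoint_of_subset_right (Finset.filter_subset _ _) (disjoint_of_greedy hX hjk))
  rw [← Finset.card_biUnion hdis]
  refine Finset.card_le_card (Finset.biUnion_subset.2 fun j hj => ?_)
  exact nbrsIn_subset_nbrsIn G _ ((Finset.filter_subset _ _).trans
    (antitone_of_greedy hX (hF j hj)))

/-- Few greedy blocks can be hit substantially by a single vertex `u`. -/
theorem card_mul_le_of_greedy (hX : ∀ n, X (n + 1) = X n \ nbrsIn G (b n) (X n))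
    (F : Finset ℕ) (h q c : ℕ) (u : V) (hF : ∀ j ∈ F, h ≤ j)
    (hq : ∀ j ∈ F, q ≤ (nbrsIn G (b j) (X j)).card)
    (hc : ∀ j ∈ F, (nbrsIn G (b j) (X j)).card ≤
      c * (nbrsIn G u (nbrsIn G (b j) (X j))).card) :
    F.card * q ≤ c * (nbrsIn G u (X h)).card :=
  calc F.card * q ≤ ∑ j ∈ F, (nbrsIn G (b j) (X j)).card := by
        rw [← smul_eq_mul]
        exact Finset.card_nsmul_le_sum _ _ _ hq
    _ ≤ ∑ j ∈ F, c * (nbrsIn G u (nbrsIn G (b j) (X j))).card := Finset.sum_le_sum hc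
    _ = c * ∑ j ∈ F, (nbrsIn G u (nbrsIn G (b j) (X j))).card := (Finset.mul_sum _ _ _).symm
    _ ≤ c * (nbrsIn G u (X h)).card :=
        Nat.mul_le_mul_left _ (sum_card_nbrsIn_le_of_greedy hX F h hF u)

/-- Deleting from each greedy block the few neighbours of later apexes produces a comb. -/
theorem exists_comb_of_greedy (hX : ∀ n, X (n + 1) = X n \ nbrsIn G (b n) (X n)) {K : ℕ}
    (hK : 0 < K) (J : Finset ℕ) (hJK : J.card = K)
    (hJR : ∀ i ∈ J, ∀ j ∈ J, j < i →
      2 * K * (nbrsIn G (b i) (nbrsIn G (b j) (X j))).card ≤ (nbrsIn G (b j) (X j)).card) :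
    ∃ (e : Fin K → ℕ) (Z : Fin K → Finset V), (∀ i, e i ∈ J) ∧
      (∀ i, Z i ⊆ nbrsIn G (b (e i)) (X (e i))) ∧ IsBlockade Z ∧
      (∀ i j, i ≠ j → ∀ c ∈ Z j, ¬ G.Adj (b (e i)) c) ∧
      ∀ i, (nbrsIn G (b (e i)) (X (e i))).card ≤ 2 * (Z i).card := by
  let e : Fin K ≃ J := (Fintype.equivFinOfCardEq (by simpa using hJK)).symm
  let Z : ℕ → Finset V := fun j =>
    nbrsIn G (b j) (X j) \ (J.filter (j < ·)).biUnion fun i => nbrsIn G (b i) (nbrsIn G (b j) (X j))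
  have hZP : ∀ j, Z j ⊆ nbrsIn G (b j) (X j) := fun j => Finset.sdiff_subset
  have hne : ∀ i j : Fin K, i ≠ j → (e i : ℕ) ≠ e j := fun i j hij h =>
    hij (e.injective (Subtype.ext h))
  have hZcard : ∀ j ∈ J, (nbrsIn G (b j) (X j)).card ≤ 2 * (Z j).card := by
    intro j hj
    have h1 : (nbrsIn G (b j) (X j)).card ≤ (Z j).card + ((J.filter (j < ·)).biUnion fun i =>
        nbrsIn G (b i) (nbrsIn G (b j) (X j))).card := by
      have := Finset.le_card_sdiff ((J.filter (j < ·)).biUnion fun i =>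
        nbrsIn G (b i) (nbrsIn G (b j) (X j))) (nbrsIn G (b j) (X j))
      simp only [Z]
      omega
    have h2 : 2 * K * ((J.filter (j < ·)).biUnion fun i =>
        nbrsIn G (b i) (nbrsIn G (b j) (X j))).card ≤ K * (nbrsIn G (b j) (X j)).card :=
      calc _ ≤ 2 * K * ∑ i ∈ J.filter (j < ·),
            (nbrsIn G (b i) (nbrsIn G (b j) (X j))).card :=
            Nat.mul_le_mul_left _ Finset.card_biUnion_le
        _ = ∑ i ∈ J.filter (j < ·),
            2 * K * (nbrsIn G (b i) (nbrsIn G (b j) (X j))).card := Finset.mul_sum _ _ _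
        _ ≤ ∑ i ∈ J.filter (j < ·), (nbrsIn G (b j) (X j)).card := Finset.sum_le_sum fun i hi => by
            rw [Finset.mem_filter] at hi
            exact hJR i hi.1 j hj hi.2
        _ ≤ K * (nbrsIn G (b j) (X j)).card := by
            rw [Finset.sum_const, smul_eq_mul]
            exact Nat.mul_le_mul_right _ (hJK ▸ Finset.card_filter_le _ _)
    have h3 : 2 * ((J.filter (j < ·)).biUnion fun i =>
        nbrsIn G (b i) (nbrsIn G (b j) (X j))).card ≤ (nbrsIn G (b j) (X j)).card :=
      Nat.le_of_mul_le_mul_left (by linarith) hK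
    omega
  refine ⟨fun i => e i, fun i => Z (e i), fun i => (e i).2, fun i => hZP _,
    ?_, ?_, fun i => hZcard _ (e i).2⟩
  · exact fun i j hij => Finset.disjoint_of_subset_left (hZP _)
      (Finset.disjoint_of_subset_right (hZP _) (disjoint_of_greedy hX (hne i j hij)))
  · intro i j hij c hc
    rcases lt_or_gt_of_ne (hne i j hij) with hlt | hlt
    · exact not_adj_of_greedy hX hlt (Finset.mem_filter.1 (hZP _ hc)).1
    · intro hadj
      refine (Finset.mem_sdiff.1 hc).2 (Finset.mem_biUnion.2 ⟨e i, ?_, ?_⟩)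
      · exact Finset.mem_filter.2 ⟨(e i).2, hlt⟩
      · exact Finset.mem_filter.2 ⟨hZP _ hc, hadj⟩

end Greedy

set_option maxHeartbeats 400000 in
/-- If every large part of `A` is hit by a vertex of `Q`, and vertices of `Q` have few neighbours
in `A`, there is a long comb with apexes in `Q` and large blocks in `A`. -/
theorem exists_comb {V : Type*} (G : SimpleGraph V) (A Q : Finset V) (x r : ℝ) (hx : 0 < x)
    (hr : 256 ≤ r) (hA : A.Nonempty)
    (hQ : ∀ u ∈ Q, ((nbrsIn G u A).card : ℝ) ≤ A.card / r ^ 2)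
    (hhit : ∀ X ⊆ A, A.card ≤ 2 * X.card → ∃ u ∈ Q, x * X.card < ((nbrsIn G u X).card : ℝ)) :
    ∃ K : ℕ, 9 ≤ K ∧ r ≤ 32 * K ∧ K * x ≤ 1 ∧
      ∃ (b : Fin K → V) (Z : Fin K → Finset V), (∀ i, b i ∈ Q) ∧ (∀ i, Z i ⊆ A) ∧
        IsBlockade Z ∧ (∀ i, ∀ c ∈ Z i, G.Adj (b i) c) ∧
        (∀ i j, i ≠ j → ∀ c ∈ Z j, ¬ G.Adj (b i) c) ∧
        ∀ i, (A.card : ℝ) * r ^ 4 ≤ 48 * 324 ^ 3 * K ^ 6 * (Z i).card := by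
  have hr0 : 0 < r := by linarith
  have ha : (0 : ℝ) < A.card := by exact_mod_cast hA.card_pos
  obtain ⟨X, b, hX0, hbQ, hX, hmax⟩ := exists_greedy_sequence G A Q (by
    obtain ⟨u, hu, -⟩ := hhit A subset_rfl (by omega)
    exact ⟨u, hu⟩)
  set p : ℕ → ℕ := fun n => (nbrsIn G (b n) (X n)).card with hp
  have hanti := antitone_of_greedy hX
  have hXA : ∀ n, X n ⊆ A := fun n => hX0 ▸ hanti (Nat.zero_le n)
  have hpanti : Antitone p := antitone_nat_of_succ_le fun n =>
    (Finset.card_le_card (nbrsIn_subset_nbrsIn G _ (hanti n.le_succ))).trans (hmax n _ (hbQ _))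
  have hsum : ∀ n, (X n).card + ∑ i ∈ Finset.range n, p i = A.card := fun n =>
    hX0 ▸ card_add_sum_of_greedy hX n
  have hppos : ∀ n, A.card ≤ 2 * (X n).card → x * (X n).card < (p n : ℝ) := fun n hn => by
    obtain ⟨u, hu, hux⟩ := hhit (X n) (hXA n) hn
    exact hux.trans_le (by exact_mod_cast hmax n u hu)
  have hex : ∃ n, 2 * (X n).card < A.card := by
    by_contra! hcon
    have h1 : ∀ n ∈ Finset.range (A.card + 1), 1 ≤ p n := fun n _ => by
      have : (0 : ℝ) < p n := (by positivity : 0 ≤ x * ((X n).card : ℝ)).trans_lt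
        (hppos n (hcon n))
      exact_mod_cast this
    have h2 : A.card + 1 ≤ ∑ i ∈ Finset.range (A.card + 1), p i := by
      simpa using Finset.card_nsmul_le_sum _ _ _ h1
    have h3 := hsum (A.card + 1)
    omega
  set M := Nat.find hex with hM
  have hMX : 2 * (X M).card < A.card := Nat.find_spec hex
  have hbig : ∀ i < M, A.card ≤ 2 * (X i).card := fun i hi => not_lt.1 (Nat.find_min hex hi)
  have hMx : M * x ≤ 2 := by
    have h1 : ∀ i ∈ Finset.range M, x * A.card / 2 ≤ (p i : ℝ) := fun i hi => by
      have h2 := hbig i (Finset.mem_range.1 hi)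
      have h3 : (A.card : ℝ) ≤ 2 * (X i).card := by exact_mod_cast h2
      nlinarith [hppos i h2]
    have h4 := Finset.card_nsmul_le_sum _ _ _ h1
    have h5 : ∑ i ∈ Finset.range M, (p i : ℝ) ≤ A.card := by
      exact_mod_cast (Nat.le_add_left _ _).trans (hsum M).le
    rw [Finset.card_range, nsmul_eq_mul] at h4
    by_contra! h
    nlinarith
  obtain ⟨n, hnM, hnr, hpn⟩ := exists_late_large_term (fun i => (p i : ℝ)) A.card r M ha hr
    (fun i => le_trans (by exact_mod_cast Finset.card_le_card (nbrsIn_subset_nbrsIn G _ (hXA i)))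
      (hQ _ (hbQ i))) (by
      have h1 : ((X M).card : ℝ) + ∑ i ∈ Finset.range M, (p i : ℝ) = A.card := by
        exact_mod_cast hsum M
      have h2 : 2 * ((X M).card : ℝ) < A.card := by exact_mod_cast hMX
      linarith)
  set z := √(n : ℝ) with hz
  have hz2 : z ^ 2 = n := Real.sq_sqrt (by positivity)
  have hzr : r / 3 ≤ z := Real.le_sqrt_of_sq_le (by nlinarith)
  have hz0 : 0 < z := by linarith
  set w := √(r * z) with hw
  have hw2 : w ^ 2 = r * z := Real.sq_sqrt (by positivity)
  have hw0 : 0 ≤ w := Real.sqrt_nonneg _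
  have hwr : r * (9 / 16) ≤ w := Real.le_sqrt_of_sq_le (by nlinarith)
  have hwz : w ≤ 2 * z := by
    rw [hw, Real.sqrt_le_left (by positivity)]
    nlinarith
  set K := ⌊w / 16⌋₊ with hK
  have hK1 : (K : ℝ) ≤ w / 16 := Nat.floor_le (by positivity)
  have hK2 : w / 16 < K + 1 := Nat.lt_floor_add_one _
  have hK9 : 9 ≤ K := Nat.le_floor (by push_cast; linarith)
  have hK9' : (9 : ℝ) ≤ K := by exact_mod_cast hK9
  have hKw : w ≤ 18 * K := by linarith
  set h := n / 2 with hh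
  have hph : (p h : ℝ) * n ≤ 2 * A.card := by
    have h1 : ∀ i ∈ Finset.range (h + 1), p h ≤ p i := fun i hi =>
      hpanti (Nat.lt_succ_iff.1 (Finset.mem_range.1 hi))
    have h2 := Finset.card_nsmul_le_sum _ _ _ h1
    rw [Finset.card_range, smul_eq_mul] at h2
    have h3 := hsum (h + 1)
    have h4 : n ≤ 2 * (h + 1) := by omega
    have h5 : p h * n ≤ 2 * A.card := by nlinarith
    exact_mod_cast h5
  set R : ℕ → ℕ → Prop := fun i j =>
    j < i ∧ p j < 2 * K * (nbrsIn G (b i) (nbrsIn G (b j) (X j))).card with hR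
  set d := ⌊96 * K * z / r⌋₊ with hd
  have hd1 : (d : ℝ) ≤ 96 * K * z / r := Nat.floor_le (by positivity)
  have hdeg : ∀ i ∈ Finset.Icc h n, ((Finset.Icc h n).filter (R i)).card ≤ d := by
    intro i hi
    rw [Finset.mem_Icc] at hi
    apply Nat.le_floor
    set F := (Finset.Icc h n).filter (R i) with hF
    have h4 : F.card * p n ≤ 2 * K * p h := 
      (card_mul_le_of_greedy hX F h (p n) (2 * K) (b i)
        (fun j hj => (Finset.mem_Icc.1 (Finset.mem_filter.1 hj).1).1)
        (fun j hj => hpanti (Finset.mem_Icc.1 (Finset.mem_filter.1 hj).1).2)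
        (fun j hj => (Finset.mem_filter.1 hj).2.2.le)).trans
        (Nat.mul_le_mul_left _ (hmax h (b i) (hbQ i)))
    have h5 : (F.card : ℝ) * p n ≤ 2 * K * p h := by exact_mod_cast h4
    have h6 : (F.card : ℝ) * (A.card * r / (24 * z ^ 3)) * n ≤ 2 * K * (2 * A.card) :=
      calc _ ≤ (F.card : ℝ) * p n * n := by gcongr
        _ ≤ 2 * K * p h * n := by gcongr
        _ = 2 * K * (p h * n) := by ring
        _ ≤ _ := by gcongr
    rw [← hz2] at h6
    have h7 : (F.card : ℝ) * (A.card * r / (24 * z ^ 3)) * z ^ 2 =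
        A.card * (F.card * r / (24 * z)) := by field_simp
    have h8 : (F.card : ℝ) * r / (24 * z) ≤ 4 * K := by
      refine le_of_mul_le_mul_left ?_ ha
      linarith
    rw [div_le_iff₀ (by positivity)] at h8
    rw [le_div_iff₀ hr0]
    linarith
  have hsize : K * (d + 1) ≤ (Finset.Icc h n).card := by
    have h1 : (n : ℝ) ≤ 2 * (Finset.Icc h n).card := by
      rw [Nat.card_Icc]
      exact_mod_cast (by omega : n ≤ 2 * (n + 1 - h))
    have h2 : (K : ℝ) * (d + 1) ≤ z ^ 2 / 2 := by
      have h3 : (K : ℝ) ^ 2 ≤ r * z / 256 :=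
        calc (K : ℝ) ^ 2 ≤ (w / 16) ^ 2 := by gcongr
          _ = r * z / 256 := by rw [div_pow, hw2]; norm_num
      calc (K : ℝ) * (d + 1) ≤ K * (96 * K * z / r + 1) := by gcongr
        _ = 96 * K ^ 2 * z / r + K := by ring
        _ ≤ 96 * (r * z / 256) * z / r + K := by gcongr
        _ = 3 / 8 * z ^ 2 + K := by field_simp; ring
        _ ≤ z ^ 2 / 2 := by linarith [(by gcongr; linarith : z * 1 ≤ z * z)]
    have h4 : (K : ℝ) * (d + 1) ≤ (Finset.Icc h n).card := by linarith
    exact_mod_cast h4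
  obtain ⟨J, hJ, hJK, hJR⟩ := exists_subset_card_eq_of_forall_card_le R d K _
    (fun i hi => by convert hdeg i hi) hsize
  obtain ⟨e, Z, heJ, hZP, hZ, hZb, hZp⟩ := exists_comb_of_greedy hX (by omega) J hJK
    fun i hi j hj hji => not_lt.1 fun h => hJR i hi j hj hji ⟨hji, h⟩
  refine ⟨K, hK9, by linarith, ?_, fun i => b (e i), Z, fun i => hbQ _,
    fun i => (hZP i).trans ((Finset.filter_subset _ _).trans (hXA _)), hZ,
    fun i c hc => (Finset.mem_filter.1 (hZP i hc)).2, hZb, ?_⟩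
  · have h1 : (n : ℝ) ≤ M := by exact_mod_cast hnM.le
    have h2 : z * 1 ≤ z * z := by gcongr; linarith
    calc (K : ℝ) * x ≤ M / 2 * x := by gcongr; linarith
      _ ≤ 1 := by linarith
  · intro i
    have h1 : p n ≤ 2 * (Z i).card :=
      (hpanti (Finset.mem_Icc.1 (hJ (heJ i))).2).trans (hZp i)
    have h2 : (p n : ℝ) ≤ 2 * (Z i).card := by exact_mod_cast h1
    have h3 : r * z ≤ 324 * K ^ 2 :=
      calc r * z = w ^ 2 := hw2.symm
        _ ≤ (18 * K) ^ 2 := by gcongr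
        _ = 324 * K ^ 2 := by ring
    have h4 : (A.card : ℝ) * r ≤ 48 * z ^ 3 * (Z i).card := by
      have := hpn.trans h2
      rw [div_le_iff₀ (by positivity)] at this
      linarith
    calc (A.card : ℝ) * r ^ 4 = r ^ 3 * (A.card * r) := by ring
      _ ≤ r ^ 3 * (48 * z ^ 3 * (Z i).card) := by gcongr
      _ = 48 * (r * z) ^ 3 * (Z i).card := by ring
      _ ≤ 48 * (324 * K ^ 2) ^ 3 * (Z i).card := by gcongr
      _ = _ := by ring

theorem sum_card_nbrsIn_comm {V : Type*} (G : SimpleGraph V) (A B : Finset V) :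
    ∑ u ∈ A, (nbrsIn G u B).card = ∑ u ∈ B, (nbrsIn G u A).card := by
  have h := Finset.sum_card_bipartiteAbove_eq_sum_card_bipartiteBelow (s := A) (t := B) G.Adj
  simpa only [Finset.bipartiteAbove, Finset.bipartiteBelow, nbrsIn, G.adj_comm] using h

/-- In a sparse graph, few vertices have many neighbours in a given set. -/
theorem card_filter_heavy_le {V : Type*} [Fintype V] {G : SimpleGraph V} {y : ℝ} (hy : 0 < y)
    (hsp : Sparse G (y ^ 3)) {A : Finset V} (hA : A.Nonempty) :
    ((Finset.univ.filter fun u => A.card * y ^ 2 < ((nbrsIn G u A).card : ℝ)).card : ℝ) ≤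
      y * Fintype.card V := by
  set F := Finset.univ.filter fun u => A.card * y ^ 2 < ((nbrsIn G u A).card : ℝ) with hF
  have ha : (0 : ℝ) < A.card := by exact_mod_cast hA.card_pos
  have h1 := Finset.card_nsmul_le_sum F (fun u => ((nbrsIn G u A).card : ℝ)) (A.card * y ^ 2)
    fun u hu => (Finset.mem_filter.1 hu).2.le
  have h2 : ∑ u ∈ F, ((nbrsIn G u A).card : ℝ) = ∑ u ∈ A, ((nbrsIn G u F).card : ℝ) := by
    exact_mod_cast sum_card_nbrsIn_comm G F A
  have h3 := Finset.sum_le_card_nsmul A (fun u => ((nbrsIn G u F).card : ℝ))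
    (y ^ 3 * Fintype.card V) fun u _ => le_trans
      (by exact_mod_cast Finset.card_le_card (nbrsIn_subset_nbrsIn G u (Finset.subset_univ F)))
      (hsp u)
  rw [nsmul_eq_mul] at h1 h3
  have hpos : 0 < A.card * y ^ 2 := by positivity
  refine le_of_mul_le_mul_right ?_ hpos
  linarith

/-- the first step for house-free sparse graphs. -/
theorem house_free_step_one
    (V : Type) [Fintype V] (G : SimpleGraph V) (x y : ℝ)
    (hx : 0 < x) (hxy : x ≤ y) (hy : y ≤ 1 / 2 ^ 8)
    (hsp : Sparse G (y ^ 3)) (hfree : Free P5ᶜ G)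
    (hcard : y ^ (-(4 : ℝ)) ≤ (Fintype.card V : ℝ)) :
    Sparse G (2 * y ^ 4) ∨
    (∃ k : ℝ, y ^ (-(1/4) : ℝ) ≤ k ∧ k ≤ 1 / x ∧
      ∃ (n : ℕ) (B : Fin n → Finset V), IsBlockade B ∧ k ≤ (n : ℝ) ∧
        (∀ i, (Fintype.card V : ℝ) / k ^ (26 : ℝ) ≤ ((B i).card : ℝ)) ∧
        PureBlockade G B) ∨
    (∃ X Y : Finset V, Disjoint X Y ∧
      y ^ 4 * (Fintype.card V : ℝ) ≤ (X.card : ℝ) ∧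
      (1 - 4 * y) * (Fintype.card V : ℝ) ≤ (Y.card : ℝ) ∧
      SparseTo G x X Y) := by

  have hy0 : 0 < y := hx.trans_le hxy
  by_cases hsparse : Sparse G (2 * y ^ 4)
  · exact Or.inl hsparse
  by_cases hXY : ∃ X Y : Finset V, Disjoint X Y ∧ y ^ 4 * (Fintype.card V : ℝ) ≤ (X.card : ℝ) ∧
      (1 - 4 * y) * (Fintype.card V : ℝ) ≤ (Y.card : ℝ) ∧ SparseTo G x X Y
  · exact Or.inr (Or.inr hXY)
  refine Or.inr (Or.inl ?_)
  simp only [Sparse, not_forall, not_le] at hsparse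
  obtain ⟨v, hv⟩ := hsparse
  have hg : (0 : ℝ) < Fintype.card V := by exact_mod_cast Fintype.card_pos_iff.2 ⟨v⟩
  set A := nbrsIn G v Finset.univ with hAdef
  have ha : (0 : ℝ) < A.card := lt_trans (by positivity) hv
  have hA : A.Nonempty := Finset.card_pos.1 (by exact_mod_cast ha)
  set r := y⁻¹ with hr
  have hr256 : 256 ≤ r := by
    rw [hr, le_inv_comm₀ (by norm_num) hy0]
    norm_num at hy ⊢
    exact hy
  have hr0 : 0 < r := by linarith
  have hry : ∀ c : ℝ, c / r ^ 2 = c * y ^ 2 := fun c => by rw [hr]; field_simp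
  set Q := Finset.univ.filter fun u =>
    ¬ G.Adj v u ∧ ((nbrsIn G u A).card : ℝ) ≤ A.card / r ^ 2 with hQ
  have hhit : ∀ X ⊆ A, A.card ≤ 2 * X.card →
      ∃ u ∈ Q, x * X.card < ((nbrsIn G u X).card : ℝ) := by
    intro X hXA hX
    by_contra! hcon
    set Y := Finset.univ.filter fun u =>
      u ∉ X ∧ ((nbrsIn G u X).card : ℝ) ≤ x * X.card with hY
    have hX' : (A.card : ℝ) ≤ 2 * X.card := by exact_mod_cast hX
    have hYcard : (Y.card : ℝ) < (1 - 4 * y) * Fintype.card V := by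
      by_contra! h
      refine hXY ⟨X, Y, Finset.disjoint_right.2 fun u hu => (Finset.mem_filter.1 hu).2.1,
        by linarith, h, fun u hu => (Finset.mem_filter.1 hu).2.2⟩
    set F := Finset.univ.filter fun u => A.card * y ^ 2 < ((nbrsIn G u A).card : ℝ) with hF
    have hFcard : (F.card : ℝ) ≤ y * Fintype.card V := card_filter_heavy_le hy0 hsp hA
    have hcover : (Finset.univ : Finset V) ⊆ Y ∪ A ∪ F := by
      intro u _
      by_cases huA : u ∈ A
      · simp [huA]
      by_cases huF : u ∈ F
      · simp [huF]
      have huQ : u ∈ Q := by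
        simp only [hAdef, hF, nbrsIn, Finset.mem_filter, Finset.mem_univ, true_and, not_lt]
          at huA huF
        simp only [hQ, Finset.mem_filter, Finset.mem_univ, true_and, hry]
        exact ⟨huA, huF⟩
      refine Finset.mem_union_left _ (Finset.mem_union_left _ ?_)
      exact Finset.mem_filter.2 ⟨Finset.mem_univ _, fun h => huA (hXA h), hcon u huQ⟩
    have hcov := (Finset.card_le_card hcover).trans
      ((Finset.card_union_le _ _).trans (Nat.add_le_add_right (Finset.card_union_le _ _) _))
    rw [Finset.card_univ] at hcov
    have hcov' : (Fintype.card V : ℝ) ≤ Y.card + A.card + F.card := by exact_mod_cast hcov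
    have hAcard : (A.card : ℝ) ≤ y ^ 3 * Fintype.card V := hsp v
    have hy3 : y ^ 3 ≤ y := pow_le_of_le_one hy0.le (hy.trans (by norm_num))
      (by norm_num)
    nlinarith
  obtain ⟨K, hK9, hKr, hKx, b, Z, hbQ, hZA, hZ, hbZ, hbZ', hZcard⟩ :=
    exists_comb G A Q x r hx hr256 hA (fun u hu => (Finset.mem_filter.1 hu).2.2) hhit
  have hK : (9 : ℝ) ≤ K := by exact_mod_cast hK9
  have hK0 : (0 : ℝ) < K := by linarith
  have hrpow : (K : ℝ) ^ (26 : ℝ) = (K : ℝ) ^ 26 := by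
    rw [← Real.rpow_natCast]
    norm_num
  obtain ⟨B, hB, hBcard, hBpure⟩ := exists_pureBlockade_of_comb hfree
    (t := (Fintype.card V : ℝ) / (K : ℝ) ^ 26) (by positivity) b Z hZ
    (fun i => (Finset.mem_filter.1 (hbQ i)).2.1)
    (fun i c hc => (Finset.mem_filter.1 (hZA i hc)).2) hbZ hbZ' (by
      intro i
      have h1 : 2 * (Fintype.card V : ℝ) ≤ A.card * r ^ 4 := by
        have : y * r = 1 := mul_inv_cancel₀ hy0.ne'
        calc 2 * (Fintype.card V : ℝ) = 2 * (y * r) ^ 4 * Fintype.card V := by rw [this]; ring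
          _ = 2 * y ^ 4 * Fintype.card V * r ^ 4 := by ring
          _ ≤ _ := by gcongr
      have h2 : (48 * 324 ^ 3 : ℝ) ≤ K ^ 19 :=
        le_trans (by norm_num) (pow_le_pow_left₀ (by norm_num) hK 19)
      have h3 : 2 * (Fintype.card V : ℝ) ≤ K ^ 25 * (Z i).card :=
        calc _ ≤ _ := h1.trans (hZcard i)
          _ ≤ (K : ℝ) ^ 19 * K ^ 6 * (Z i).card := by gcongr
          _ = _ := by ring
      calc 2 * ((Fintype.card V : ℝ) / (K : ℝ) ^ 26) * K
          = 2 * (Fintype.card V : ℝ) / K ^ 25 := by field_simp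
        _ ≤ ((Z i).card : ℝ) := by
          rw [div_le_iff₀ (by positivity)]
          linarith)
  refine ⟨K, ?_, (le_div_iff₀ hx).2 hKx, K, B, hB, le_rfl, fun i => ?_, hBpure⟩
  · have h1 : r ≤ (K : ℝ) ^ 4 := by
      nlinarith [pow_le_pow_left₀ (by norm_num) hK 3]
    calc y ^ (-(1/4) : ℝ) = r ^ (1/4 : ℝ) := by
          rw [hr, Real.inv_rpow hy0.le, Real.rpow_neg hy0.le]
      _ ≤ ((K : ℝ) ^ 4) ^ (1/4 : ℝ) := by gcongr
      _ = K := by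
          rw [← Real.rpow_natCast, ← Real.rpow_mul hK0.le]
          norm_num
  · rw [hrpow]
    exact hBcard i
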